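/- Let T be a combined knowledge base with answerset(Ĉ, Q_ref, T) nonempty, and let minsup ∈ (0, 1]. If a pattern Q_1 over T is not frequent (support(Ĉ, Q_1, T) < minsup), then no pattern Q_2 obtained from Q_1 by adding finitely many atoms to its body (together with the O-atoms of any newly introduced variables) is frequent. -/

import Mathlib

/-!
Semantic formalization of onto-relational frequent pattern discovery.

We fix a relational first-order language `L` with relation symbols `Rel`
(of arities `arity`), a finite nonempty set `Const` of constant symbols
(the named individuals), and distinguished unary predicates `O` and `Ĉ`
(the reference concept, called `refC` below).

First-order structures for `L` are represented by `Struc`.  A combined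
knowledge base `T` is represented semantically, by its class of models
(`KB.models`), which is required to satisfy the facts `O(cᵢ)` and the
axiom `∀ y, O(y) → y = c₁ ∨ … ∨ cₙ`; entailment `T ⊨ φ` then means that
`φ` holds in every member of `KB.models`.

A pattern `Q` has `m` undistinguished variables and a finite list of atoms;
the variable `none : Option (Fin m)` is the distinguished variable `key`
and `some i` is `xᵢ`.  Its body is `Ĉ(key) ∧ B₁ ∧ … ∧ B_k ∧ O(key) ∧ ⋀ᵢ O(xᵢ)`,
whose satisfaction under a valuation is `Pattern.BodyHolds`.
-/

namespace FPD

/-- A first-order structure for the relational language. -/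
structure Struc (Rel : Type) (arity : Rel → ℕ) (Const : Type) : Type 1 where
  /-- the domain of the structure -/
  M : Type
  /-- interpretation of the ordinary relation symbols -/
  rel : (r : Rel) → (Fin (arity r) → M) → Prop
  /-- interpretation of the distinguished reference concept `Ĉ` -/
  refC : M → Prop
  /-- interpretation of the distinguished unary predicate `O` -/
  O : M → Prop
  /-- interpretation of the constant symbols (named individuals) -/
  const : Const → M

/-- An atom over variables `V`: a relation symbol applied to terms,
each term being a variable (`Sum.inl`) or a constant symbol (`Sum.inr`). -/
structure Atom (Rel : Type) (arity : Rel → ℕ) (Const : Type) (V : Type) where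
  r : Rel
  args : Fin (arity r) → V ⊕ Const

variable {Rel : Type} {arity : Rel → ℕ} {Const : Type}

/-- Satisfaction of an atom in a structure `S` under a valuation `v` of the variables. -/
def Atom.Holds {V : Type} (S : Struc Rel arity Const) (B : Atom Rel arity Const V)
    (v : V → S.M) : Prop :=
  S.rel B.r fun i => Sum.elim v S.const (B.args i)

/-- The variable `x` occurs in the atom `B`. -/
def Atom.hasVar {V : Type} (B : Atom Rel arity Const V) (x : V) : Prop :=
  ∃ i, B.args i = Sum.inl x

/-- Renaming the variables of an atom. -/
def Atom.map {V W : Type} (f : V → W) (B : Atom Rel arity Const V) :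
    Atom Rel arity Const W :=
  ⟨B.r, fun i => Sum.map f id (B.args i)⟩

/-- A pattern (conjunctive DL-safe query): `m` undistinguished variables
`x₁, …, x_m` and a finite list of atoms `B₁, …, B_k`; the variable
`none : Option (Fin m)` is the distinguished variable `key`. -/
structure Pattern (Rel : Type) (arity : Rel → ℕ) (Const : Type) where
  m : ℕ
  atoms : List (Atom Rel arity Const (Option (Fin m)))

/-- Satisfaction of the body `Ĉ(key) ∧ B₁ ∧ … ∧ B_k ∧ O(key) ∧ O(x₁) ∧ … ∧ O(x_m)`
of a pattern in a structure `S`, with `key` valued `a` and `xᵢ` valued `xs i`. -/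
def Pattern.BodyHolds (S : Struc Rel arity Const) (Q : Pattern Rel arity Const)
    (a : S.M) (xs : Fin Q.m → S.M) : Prop :=
  S.refC a ∧ (∀ B ∈ Q.atoms, B.Holds S fun v => v.elim a xs) ∧ S.O a ∧ ∀ i, S.O (xs i)

/-- A combined knowledge base, represented semantically by its class of models:
every model satisfies the facts `O(cᵢ)` for each named constant, and the
axiom that `O` holds only of (interpretations of) named constants. -/
structure KB (Rel : Type) (arity : Rel → ℕ) (Const : Type) : Type 1 where
  models : Set (Struc Rel arity Const)
  O_const : ∀ S ∈ models, ∀ c : Const, S.O (S.const c)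
  O_named : ∀ S ∈ models, ∀ y : S.M, S.O y → ∃ c : Const, y = S.const c

/-- `T.Geq Q₁ Q₂` : pattern `Q₂` is contained in pattern `Q₁` w.r.t. `T`
(`Q₁ ⊒ Q₂`, `Q₁` is at least as general as `Q₂`), i.e.
`T ⊨ ∀ key (∃ x⃗₂ body(Q₂) → ∃ x⃗₁ body(Q₁))`. -/
def KB.Geq (T : KB Rel arity Const) (Q1 Q2 : Pattern Rel arity Const) : Prop :=
  ∀ S ∈ T.models, ∀ a : S.M,
    (∃ xs, Q2.BodyHolds S a xs) → ∃ xs, Q1.BodyHolds S a xs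

/-- Semantic equivalence of patterns: `Q₁ ≡ Q₂` iff `Q₁ ⊒ Q₂` and `Q₂ ⊒ Q₁`. -/
def KB.Equiv (T : KB Rel arity Const) (Q1 Q2 : Pattern Rel arity Const) : Prop :=
  T.Geq Q1 Q2 ∧ T.Geq Q2 Q1

/-- The answer set of pattern `Q` w.r.t. `T`: the constants `c` such that
`T ⊨ ∃ x₁ … x_m body(Q)[key := c]`. -/
def KB.answerset (T : KB Rel arity Const) (Q : Pattern Rel arity Const) : Set Const :=
  {c | ∀ S ∈ T.models, ∃ xs, Q.BodyHolds S (S.const c) xs}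

/-- The trivial (reference) pattern `Q_ref`, with body `Ĉ(key) ∧ O(key)`. -/
def trivialPattern (Rel : Type) (arity : Rel → ℕ) (Const : Type) :
    Pattern Rel arity Const :=
  ⟨0, []⟩

/-- The support of `Q` w.r.t. `T`:
`|answerset(Ĉ, Q, T)| / |answerset(Ĉ, Q_ref, T)|`. -/
noncomputable def KB.support (T : KB Rel arity Const) (Q : Pattern Rel arity Const) : ℝ :=
  ((T.answerset Q).ncard : ℝ) / ((T.answerset (trivialPattern Rel arity Const)).ncard : ℝ)

/-- The pattern obtained from `Q` by adding one atom `B` to its body, possibly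
introducing `p` new undistinguished variables (whose `O`-atoms are part of the
body of the resulting pattern as well); the old variables are kept (embedded
via `Fin.castAdd`). -/
def Pattern.addAtom (Q : Pattern Rel arity Const) (p : ℕ)
    (B : Atom Rel arity Const (Option (Fin (Q.m + p)))) : Pattern Rel arity Const :=
  ⟨Q.m + p, Q.atoms.map (Atom.map (Option.map (Fin.castAdd p))) ++ [B]⟩

/-- A variable `x` of `Q` is linked iff `x = key`, or some atom of `body(Q)`
contains `x` together with a distinct linked variable. -/
inductive Pattern.LinkedVar (Q : Pattern Rel arity Const) : Option (Fin Q.m) → Prop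
  | key : Q.LinkedVar none
  | step {x y : Option (Fin Q.m)} {B : Atom Rel arity Const (Option (Fin Q.m))} :
      B ∈ Q.atoms → B.hasVar x → B.hasVar y → x ≠ y → Q.LinkedVar y → Q.LinkedVar x

/-- A pattern is linked iff every one of its variables is linked. -/
def Pattern.IsLinked (Q : Pattern Rel arity Const) : Prop :=
  ∀ x : Option (Fin Q.m), Q.LinkedVar x

variable {Rel : Type} {arity : Rel → ℕ} {Const : Type} [Fintype Const] [Nonempty Const]

/-- `Q₂` is obtained from `Q₁` by adding finitely many atoms to its body
(together with the `O`-atoms of any newly introduced variables). -/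
def Pattern.ExtendsBy (Q1 Q2 : Pattern Rel arity Const) : Prop :=
  Relation.ReflTransGen
    (fun Q Q' => ∃ (p : ℕ) (B : Atom Rel arity Const (Option (Fin (Q.m + p)))),
      Q' = Q.addAtom p B) Q1 Q2

section Monotonicity

variable {R : Type} {ar : R → ℕ} {C : Type}

theorem Atom.holds_map {V W : Type} (S : Struc R ar C) (f : V → W) (B : Atom R ar C V)
    (v : W → S.M) : (B.map f).Holds S v ↔ B.Holds S (v ∘ f) := by
  simp only [Atom.Holds, Atom.map, Sum.elim_map, Function.comp_id]

theorem Pattern.BodyHolds.of_addAtom {S : Struc R ar C} {Q : Pattern R ar C} {p : ℕ}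
    {B : Atom R ar C (Option (Fin (Q.m + p)))} {a : S.M} {xs : Fin (Q.m + p) → S.M}
    (h : (Q.addAtom p B).BodyHolds S a xs) : Q.BodyHolds S a (xs ∘ Fin.castAdd p) := by
  obtain ⟨hC, hB, hO, hxs⟩ := h
  refine ⟨hC, fun A hA => ?_, hO, fun i => hxs (Fin.castAdd p i)⟩
  have hA' := (Atom.holds_map S _ A _).1
    (hB _ (List.mem_append_left _ (List.mem_map_of_mem hA)))
  convert hA' using 1
  funext v
  cases v <;> rfl

theorem KB.answerset_addAtom_subset (T : KB R ar C) (Q : Pattern R ar C) (p : ℕ)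
    (B : Atom R ar C (Option (Fin (Q.m + p)))) :
    T.answerset (Q.addAtom p B) ⊆ T.answerset Q := fun _ hc S hS =>
  let ⟨_, hxs⟩ := hc S hS
  ⟨_, hxs.of_addAtom⟩

theorem KB.answerset_subset_of_extendsBy (T : KB R ar C) {Q1 Q2 : Pattern R ar C}
    (h : Pattern.ExtendsBy Q1 Q2) : T.answerset Q2 ⊆ T.answerset Q1 := by
  induction h with
  | refl => exact subset_rfl
  | tail _ hstep ih =>
    obtain ⟨p, B, rfl⟩ := hstep
    exact (T.answerset_addAtom_subset _ p B).trans ih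

theorem KB.support_le_of_extendsBy [Finite C] (T : KB R ar C) {Q1 Q2 : Pattern R ar C}
    (h : Pattern.ExtendsBy Q1 Q2) : T.support Q2 ≤ T.support Q1 := by
  unfold KB.support
  gcongr
  · exact Set.toFinite _
  · exact T.answerset_subset_of_extendsBy h

end Monotonicity

/-- Anti-monotonicity of infrequency.  Let `T` be a combined
knowledge base with `answerset(Ĉ, Q_ref, T)` nonempty and `minsup ∈ (0, 1]`.
If a pattern `Q₁` is not frequent (`support(Ĉ, Q₁, T) < minsup`), then no
pattern `Q₂` obtained from `Q₁` by adding finitely many atoms to its body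
(together with the `O`-atoms of newly introduced variables) is frequent. -/
theorem not_frequent_of_extends (T : KB Rel arity Const)
    (href : (T.answerset (trivialPattern Rel arity Const)).Nonempty)
    (minsup : ℝ) (hpos : 0 < minsup) (hle : minsup ≤ 1)
    (Q1 Q2 : Pattern Rel arity Const)
    (hinfreq : T.support Q1 < minsup)
    (hext : Pattern.ExtendsBy Q1 Q2) :
    ¬ minsup ≤ T.support Q2 := by
  exact not_le.2 ((T.support_le_of_extendsBy hext).trans_lt hinfreq)

end FPD
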